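/- arXiv:1810.02708 — 2 statements merged into one kernel-verified Lean document; each statement's English description precedes it below -/
import Mathlib

section
/- Let X be an m×k complex matrix with k < m and full column rank k. Then there exists a unitary matrix H which is k-upper Hessenberg (i.e., H(i,j) = 0 whenever i > j + k) and an m×k matrix T with T(1:k,1:k) upper triangular and nonsingular and T(k+1:m,:) = 0, such that H·X = T. -/
/-- Every square complex matrix is brought to upper triangular form by left multiplication with a
unitary matrix (existence of the QR factorization). -/
theorem exists_unitary_mul_upperTriangular {m : ℕ} (M : Matrix (Fin m) (Fin m) ℂ) :
    ∃ H ∈ Matrix.unitaryGroup (Fin m) ℂ, ∀ i j : Fin m, j < i → (H * M) i j = 0 := by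
  let f : Fin m → EuclideanSpace ℂ (Fin m) := fun l => WithLp.toLp 2 (M.col l)
  let b := InnerProductSpace.gramSchmidtOrthonormalBasis (𝕜 := ℂ)
    (by simp : Module.finrank ℂ (EuclideanSpace ℂ (Fin m)) = Fintype.card (Fin m)) f
  refine ⟨Matrix.of fun i j => star (b i j), ?_, fun i j hij => ?_⟩
  · rw [Matrix.mem_unitaryGroup_iff]
    ext i j
    have h := orthonormal_iff_ite.mp b.orthonormal i j
    rw [PiLp.inner_apply] at h
    simpa [Matrix.mul_apply, Matrix.star_apply, Matrix.one_apply, mul_comm] using h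
  · have h : inner ℂ (b i) (f j) = 0 :=
      InnerProductSpace.gramSchmidtOrthonormalBasis_inv_triangular _ f hij
    rw [PiLp.inner_apply] at h
    simpa [Matrix.mul_apply, f, mul_comm] using h

theorem Matrix.mulVec_injective_of_rank_eq {K ι : Type*} [Field K] [Fintype ι] {k : ℕ}
    {X : Matrix ι (Fin k) K} (hX : X.rank = k) : Function.Injective X.mulVec := by
  have h := LinearMap.finrank_range_add_finrank_ker X.mulVecLin
  rw [← Matrix.rank, hX, Module.finrank_fin_fun] at h
  have hker : LinearMap.ker X.mulVecLin = ⊥ := Submodule.finrank_eq_zero.mp (by omega)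
  exact LinearMap.ker_eq_bot.mp hker

theorem stmt_3 {m k : ℕ} (hk : k < m) (X : Matrix (Fin m) (Fin k) ℂ) (hX : X.rank = k) :
    ∃ H : Matrix (Fin m) (Fin m) ℂ, H ∈ Matrix.unitaryGroup (Fin m) ℂ ∧
      (∀ i j : Fin m, (j : ℕ) + k < (i : ℕ) → H i j = 0) ∧
      ∃ T : Matrix (Fin m) (Fin k) ℂ, H * X = T ∧
        (∀ i j : Fin k, (j : ℕ) < (i : ℕ) → T (Fin.castLE hk.le i) j = 0) ∧
        (∀ i : Fin m, k ≤ (i : ℕ) → ∀ j, T i j = 0) ∧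
        IsUnit (Matrix.det (Matrix.of fun i j : Fin k => T (Fin.castLE hk.le i) j)) := by
  let M : Matrix (Fin m) (Fin m) ℂ := Matrix.of fun i l =>
    if h : (l : ℕ) < k then X i ⟨l, h⟩ else if (i : ℕ) + k = l then 1 else 0
  obtain ⟨H, hH, hHM⟩ := exists_unitary_mul_upperTriangular M
  have hT (i : Fin m) (j : Fin k) (hij : (j : ℕ) < i) : (H * X) i j = 0 := by
    have h := hHM i (Fin.castLE hk.le j) hij
    simpa [Matrix.mul_apply, M] using h
  have hzero (i : Fin m) (hi : k ≤ (i : ℕ)) (j : Fin k) : (H * X) i j = 0 :=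
    hT i j (j.isLt.trans_le hi)
  refine ⟨H, hH, fun i j hij => ?_, H * X, rfl, fun i j hij => hT _ j hij, hzero, ?_⟩
  · have h := hHM i ⟨j + k, hij.trans i.isLt⟩ hij
    simpa [Matrix.mul_apply, M, Fin.val_inj] using h
  · rw [isUnit_iff_ne_zero]
    intro hdet
    obtain ⟨v, hv, hTv⟩ := Matrix.exists_mulVec_eq_zero_iff.mpr hdet
    have hHXv : (H * X).mulVec v = 0 := by
      ext i
      by_cases hi : (i : ℕ) < k
      · exact congrFun hTv ⟨i, hi⟩
      · simp [Matrix.mulVec, dotProduct, hzero i (not_lt.mp hi)]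
    have hXv : X.mulVec v = 0 := by
      have h := congrArg (star H).mulVec hHXv
      rwa [Matrix.mulVec_mulVec, ← Matrix.mul_assoc, Matrix.mem_unitaryGroup_iff'.mp hH,
        Matrix.one_mul, Matrix.mulVec_zero] at h
    exact hv (Matrix.mulVec_injective_of_rank_eq hX (hXv.trans (Matrix.mulVec_zero X).symm))
end

section
/- Let A = U + X·Yᴴ be an n×n complex matrix with U unitary and X, Y ∈ ℂ^{n×k} of full rank k. Then there exists an N×N matrix Â with N = n+k of the form Â = Û + X̂·Ŷᴴ, where Û is unitary, X̂, Ŷ ∈ ℂ^{N×k} have full rank, X̂(n+1:N, :) = −I_k, and Â has the block form [[A, B],[0, 0]] for some B ∈ ℂ^{n×k}. -/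
open scoped Matrix

theorem Matrix.rank_eq_card_of_mul_eq_one {m n : Type*} [Fintype m] [Fintype n] [DecidableEq n]
    {L : Matrix n m ℂ} {M : Matrix m n ℂ} (h : L * M = 1) : M.rank = Fintype.card n := by
  refine le_antisymm M.rank_le_card_width ?_
  have := Matrix.rank_mul_le_right L M
  rwa [h, Matrix.rank_one] at this

open scoped MatrixOrder ComplexOrder in
/-- A matrix of full column rank factors as an isometry times a square matrix. -/
theorem Matrix.exists_isometry_mul_of_rank_eq {m n : Type*} [Fintype m] [Fintype n]
    [DecidableEq n] (Y : Matrix m n ℂ) (hY : Y.rank = Fintype.card n) :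
    ∃ (Q : Matrix m n ℂ) (R : Matrix n n ℂ), Qᴴ * Q = 1 ∧ Y = Q * R := by
  obtain ⟨R, hR⟩ : ∃ R : Matrix n n ℂ, Yᴴ * Y = Rᴴ * R := by
    exact CStarAlgebra.nonneg_iff_eq_star_mul_self.mp
      (Matrix.posSemidef_conjTranspose_mul_self Y).nonneg
  have hrank : R.rank = Fintype.card n := by
    rw [← Matrix.rank_conjTranspose_mul_self, ← hR, Matrix.rank_conjTranspose_mul_self, hY]
  have hunit : IsUnit R := by
    rw [← Matrix.linearIndependent_cols_iff_isUnit, linearIndependent_iff_card_eq_finrank_span,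
      Set.finrank, ← Matrix.rank_eq_finrank_span_cols, hrank]
  have hdet := (Matrix.isUnit_iff_isUnit_det R).mp hunit
  refine ⟨Y * R⁻¹, R, ?_, (Matrix.nonsing_inv_mul_cancel_right R Y hdet).symm⟩
  rw [Matrix.conjTranspose_mul, Matrix.mul_assoc, ← Matrix.mul_assoc Yᴴ, hR, Matrix.mul_assoc,
    Matrix.mul_nonsing_inv R hdet, Matrix.mul_one, ← Matrix.conjTranspose_mul,
    Matrix.mul_nonsing_inv R hdet, Matrix.conjTranspose_one]

theorem Matrix.fromBlocks_isometry_mem_unitaryGroup {m n : Type*} [Fintype m] [Fintype n]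
    [DecidableEq m] [DecidableEq n] {U : Matrix m m ℂ} (hU : U ∈ Matrix.unitaryGroup m ℂ)
    {Q : Matrix m n ℂ} (hQ : Qᴴ * Q = 1) :
    Matrix.fromBlocks (U - U * Q * Qᴴ) (U * Q) Qᴴ 0 ∈ Matrix.unitaryGroup (m ⊕ n) ℂ := by
  have hU' : U * Uᴴ = 1 := Matrix.mem_unitaryGroup_iff.mp hU
  have hQl (M : Matrix n m ℂ) : Qᴴ * (Q * M) = M := by
    rw [← Matrix.mul_assoc, hQ, Matrix.one_mul]
  rw [Matrix.mem_unitaryGroup_iff, Matrix.star_eq_conjTranspose, Matrix.fromBlocks_conjTranspose,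
    Matrix.fromBlocks_multiply, ← Matrix.fromBlocks_one]
  congr 1 <;>
    simp [Matrix.mul_assoc, Matrix.sub_mul, Matrix.mul_sub, hQ, hQl, hU']

theorem stmt_6 {n k : ℕ} (U : Matrix (Fin n) (Fin n) ℂ)
    (hU : U ∈ Matrix.unitaryGroup (Fin n) ℂ)
    (X Y : Matrix (Fin n) (Fin k) ℂ) (hX : X.rank = k) (hY : Y.rank = k) :
    ∃ (Uh : Matrix (Fin n ⊕ Fin k) (Fin n ⊕ Fin k) ℂ)
      (Xh Yh : Matrix (Fin n ⊕ Fin k) (Fin k) ℂ) (B : Matrix (Fin n) (Fin k) ℂ),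
      Uh ∈ Matrix.unitaryGroup (Fin n ⊕ Fin k) ℂ ∧ Xh.rank = k ∧ Yh.rank = k ∧
      (∀ i j : Fin k, Xh (Sum.inr i) j = -(1 : Matrix (Fin k) (Fin k) ℂ) i j) ∧
      Uh + Xh * Yhᴴ = Matrix.fromBlocks (U + X * Yᴴ) B 0 0 := by
  obtain ⟨Q, R, hQ, rfl⟩ := Y.exists_isometry_mul_of_rank_eq (by simpa using hY)
  refine ⟨Matrix.fromBlocks (U - U * Q * Qᴴ) (U * Q) Qᴴ 0,
    Matrix.fromRows (X * Rᴴ + U * Q) (-1), Matrix.fromRows Q 0, U * Q,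
    Matrix.fromBlocks_isometry_mem_unitaryGroup hU hQ, ?_, ?_, fun i j => rfl, ?_⟩
  · simpa using Matrix.rank_eq_card_of_mul_eq_one (L := Matrix.fromCols 0 (-1))
      (M := Matrix.fromRows (X * Rᴴ + U * Q) (-1)) (by simp [Matrix.fromCols_mul_fromRows])
  · simpa using Matrix.rank_eq_card_of_mul_eq_one (L := Matrix.fromCols Qᴴ 0)
      (M := Matrix.fromRows Q (0 : Matrix (Fin k) (Fin k) ℂ))
      (by simp [Matrix.fromCols_mul_fromRows, hQ])
  · rw [Matrix.conjTranspose_fromRows_eq_fromCols_conjTranspose, Matrix.fromRows_mul_fromCols,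
      Matrix.fromBlocks_add]
    congr 1 <;> simp [Matrix.add_mul, Matrix.mul_assoc]
end
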